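/- Let Ω be a quaternionic hyperconvex domain in ℍⁿ and K ⊂ Ω a compact set such that the upper semicontinuous regularization u*_{K,Ω} is identically −1 on K. Then the relatively extremal function u_{K,Ω} is continuous in Ω. -/

import Mathlib

/- ## Preliminaries: quaternionic pluripotential theory -/

open MeasureTheory Filter Topology
open scoped Quaternion ENNReal

noncomputable section

/-- Borel measurable structure on the quaternions. -/
instance : MeasurableSpace ℍ := borel ℍ
instance : BorelSpace ℍ := ⟨rfl⟩

/-- Lebesgue measure on the quaternions, transported from `ℝ⁴`. -/
instance : MeasureSpace ℍ :=
  ⟨Measure.map Quaternion.linearIsometryEquivTuple.symm volume⟩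

instance : SigmaFinite (volume : Measure ℍ) := by
  have h : (volume : Measure ℍ) =
      Measure.map
        (Quaternion.linearIsometryEquivTuple.toHomeomorph.symm.toMeasurableEquiv) volume := rfl
  rw [h]
  exact MeasurableEquiv.sigmaFinite_map _

/-- `n`-dimensional quaternionic space `ℍⁿ`. -/
abbrev Hn (n : ℕ) := Fin n → ℍ

/-! ### Subharmonic and quaternionic plurisubharmonic functions -/

/-- Second directional derivative. -/
def secondDeriv (h : ℍ → ℝ) (x v : ℍ) : ℝ :=
  fderiv ℝ (fun y => fderiv ℝ h y v) x v

/-- The Laplacian on `ℍ ≅ ℝ⁴`. -/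
def lapQ (h : ℍ → ℝ) (x : ℍ) : ℝ :=
  secondDeriv h x 1 + secondDeriv h x ⟨0, 1, 0, 0⟩ +
    secondDeriv h x ⟨0, 0, 1, 0⟩ + secondDeriv h x ⟨0, 0, 0, 1⟩

/-- A real-valued function is harmonic on a set if it is `C²` there with vanishing
Laplacian. -/
def HarmonicOnQ (h : ℍ → ℝ) (s : Set ℍ) : Prop :=
  ContDiffOn ℝ 2 h s ∧ ∀ x ∈ s, lapQ h x = 0

/-- A `[-∞,∞)`-valued function is subharmonic on `s ⊆ ℍ ≅ ℝ⁴` (in the usual sense) if it is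
upper semicontinuous and lies below every harmonic majorant on closed balls. -/
def SubharmonicOn (u : ℍ → EReal) (s : Set ℍ) : Prop :=
  UpperSemicontinuousOn u s ∧ (∀ x ∈ s, u x ≠ ⊤) ∧
  ∀ (x : ℍ) (r : ℝ), 0 < r → Metric.closedBall x r ⊆ s →
    ∀ h : ℍ → ℝ, ContinuousOn h (Metric.closedBall x r) →
      HarmonicOnQ h (Metric.ball x r) →
      (∀ y ∈ Metric.sphere x r, u y ≤ (h y : EReal)) →
      ∀ y ∈ Metric.closedBall x r, u y ≤ (h y : EReal)

/-- The right quaternionic line through `a` with direction `b`. -/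
def qLine {n : ℕ} (a b : Hn n) (t : ℍ) : Hn n := fun k => a k + b k * t

/-- A `[-∞,∞)`-valued function is quaternionic plurisubharmonic on `Ω` if it is upper
semicontinuous on `Ω` and its restriction to every right quaternionic line is subharmonic. -/
def QPSH {n : ℕ} (u : Hn n → EReal) (Ω : Set (Hn n)) : Prop :=
  UpperSemicontinuousOn u Ω ∧ (∀ q ∈ Ω, u q ≠ ⊤) ∧
  ∀ a b : Hn n, SubharmonicOn (fun t => u (qLine a b t)) {t : ℍ | qLine a b t ∈ Ω}

/-- Quaternionic plurisubharmonicity for real-valued functions. -/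
def QPSHr {n : ℕ} (u : Hn n → ℝ) (Ω : Set (Hn n)) : Prop :=
  QPSH (fun q => (u q : EReal)) Ω

/-- A quaternionic hyperconvex domain: open, bounded, connected, admitting a negative
plurisubharmonic exhaustion function. -/
def QHyperconvex {n : ℕ} (Ω : Set (Hn n)) : Prop :=
  IsOpen Ω ∧ Bornology.IsBounded Ω ∧ IsConnected Ω ∧
  ∃ ρ : Hn n → EReal, QPSH ρ Ω ∧ (∀ q ∈ Ω, ρ q < 0) ∧
    ∀ c : ℝ, c < 0 →
      IsCompact (closure {q | q ∈ Ω ∧ ρ q < (c : EReal)}) ∧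
      closure {q | q ∈ Ω ∧ ρ q < (c : EReal)} ⊆ Ω

/-! ### The quaternionic Monge–Ampère operator on smooth functions -/

/-- The four quaternionic units. -/
def unitQ : Fin 4 → ℍ
  | 0 => 1
  | 1 => ⟨0, 1, 0, 0⟩
  | 2 => ⟨0, 0, 1, 0⟩
  | 3 => ⟨0, 0, 0, 1⟩

/-- The coordinate direction `x_{4l+m}` in `ℍⁿ ≅ ℝ^{4n}`. -/
def dirQ {n : ℕ} (l : Fin n) (m : Fin 4) : Hn n := fun k => if k = l then unitQ m else 0

/-- Real partial derivative of a complex-valued function in the direction `v`. -/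
def pdQ {n : ℕ} (v : Hn n) (f : Hn n → ℂ) (q : Hn n) : ℂ := fderiv ℝ f q v

/-- The first-order differential operators `∇_{jα}`, `j < 2n`, `α < 2`. -/
def nablaQ {n : ℕ} (j : Fin (2 * n)) (α : Fin 2) (f : Hn n → ℂ) (q : Hn n) : ℂ :=
  let l : Fin n := ⟨j.val / 2, by omega⟩
  if j.val % 2 = 0 then
    (if α = 0 then pdQ (dirQ l 0) f q + Complex.I * pdQ (dirQ l 1) f q
     else - pdQ (dirQ l 2) f q - Complex.I * pdQ (dirQ l 3) f q)
  else
    (if α = 0 then pdQ (dirQ l 2) f q - Complex.I * pdQ (dirQ l 3) f q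
     else pdQ (dirQ l 0) f q - Complex.I * pdQ (dirQ l 1) f q)

/-- The Baston coefficients `Δ_{ij} u = ½(∇_{i0}∇_{j1}u − ∇_{i1}∇_{j0}u)`. -/
def bastonQ {n : ℕ} (i j : Fin (2 * n)) (u : Hn n → ℝ) (q : Hn n) : ℂ :=
  (1 / 2 : ℂ) * (nablaQ i 0 (fun x => nablaQ j 1 (fun y => (u y : ℂ)) x) q -
    nablaQ i 1 (fun x => nablaQ j 0 (fun y => (u y : ℂ)) x) q)

/-- The coefficients of `γ(u,v) = ½(d₀u∧d₁v − d₁u∧d₀v)`. -/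
def gammaQ {n : ℕ} (i j : Fin (2 * n)) (u v : Hn n → ℝ) (q : Hn n) : ℂ :=
  (1 / 2 : ℂ) * (nablaQ i 0 (fun y => (u y : ℂ)) q * nablaQ j 1 (fun y => (v y : ℂ)) q -
    nablaQ i 1 (fun y => (u y : ℂ)) q * nablaQ j 0 (fun y => (v y : ℂ)) q)

/-- The sign `δ^{i₁j₁…iₙjₙ}_{01…(2n-1)}` of a (possibly non-bijective) index assignment. -/
def permSignC {m : ℕ} (f : Fin m → Fin m) : ℂ :=
  if h : Function.Bijective f then ((Equiv.Perm.sign (Equiv.ofBijective f h) : ℤ) : ℂ) else 0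

/-- Flattening of `(i₁,j₁,…,iₙ,jₙ)` into a self-map of `Fin (2n)`. -/
def flattenQ {n : ℕ} (σ : Fin n → Fin (2 * n) × Fin (2 * n)) : Fin (2 * n) → Fin (2 * n) :=
  fun j => if j.val % 2 = 0 then (σ ⟨j.val / 2, by omega⟩).1 else (σ ⟨j.val / 2, by omega⟩).2

/-- Density of the mixed quaternionic Monge–Ampère form
`△u₁∧…∧△uₙ = (∑ δ…Δ_{i₁j₁}u₁⋯Δ_{iₙjₙ}uₙ) Ω_{2n}` of smooth functions. -/
def maDensity {n : ℕ} (us : Fin n → (Hn n → ℝ)) (q : Hn n) : ℝ :=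
  (∑ σ : Fin n → Fin (2 * n) × Fin (2 * n),
    permSignC (flattenQ σ) * ∏ k : Fin n, bastonQ (σ k).1 (σ k).2 (us k) q).re

/-- Density of `γ(u,v)∧△w₁∧…∧△wₘ` for smooth functions on `ℍ^{m+1}`. -/
def gammaDensity {m : ℕ} (u v : Hn (m + 1) → ℝ) (ws : Fin m → (Hn (m + 1) → ℝ))
    (q : Hn (m + 1)) : ℝ :=
  (∑ σ : Fin (m + 1) → Fin (2 * (m + 1)) × Fin (2 * (m + 1)),
    permSignC (flattenQ σ) *
      (gammaQ (σ 0).1 (σ 0).2 u v q *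
        ∏ k : Fin m, bastonQ (σ k.succ).1 (σ k.succ).2 (ws k) q)).re

/-- The mixed Monge–Ampère measure of smooth functions on `U`. -/
def smoothMA {n : ℕ} (us : Fin n → (Hn n → ℝ)) (U : Set (Hn n)) : Measure (Hn n) :=
  (volume.restrict U).withDensity fun q => ENNReal.ofReal (maDensity us q)

/-! ### Weak convergence and the Bedford–Taylor extension to locally bounded PSH functions -/

/-- Weak convergence of measures against continuous test functions compactly supported in `Ω`. -/
def TendstoWeaklyOn {n : ℕ} (μs : ℕ → Measure (Hn n)) (μ : Measure (Hn n))
    (Ω : Set (Hn n)) : Prop :=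
  ∀ f : Hn n → ℝ, Continuous f → HasCompactSupport f → tsupport f ⊆ Ω →
    Tendsto (fun j => ∫ q, f q ∂(μs j)) atTop (𝓝 (∫ q, f q ∂μ))

/-- `μ` is the mixed Monge–Ampère measure `△u₁∧…∧△uₙ` of the locally bounded
plurisubharmonic functions `us` on `Ω`: on every relatively compact open subset it is the
weak limit of the Monge–Ampère measures of smooth plurisubharmonic functions decreasing
to the `us`. -/
def IsMixedMA {n : ℕ} (Ω : Set (Hn n)) (us : Fin n → (Hn n → ℝ)) (μ : Measure (Hn n)) : Prop :=
  (∀ U : Set (Hn n), IsOpen U → IsCompact (closure U) → closure U ⊆ Ω →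
    ∀ fs : Fin n → ℕ → (Hn n → ℝ),
      (∀ k j, ContDiff ℝ (⊤ : ℕ∞) (fs k j) ∧ QPSHr (fs k j) U) →
      (∀ k, ∀ q ∈ U, Antitone fun j => fs k j q) →
      (∀ k, ∀ q ∈ U, Tendsto (fun j => fs k j q) atTop (𝓝 (us k q))) →
      TendstoWeaklyOn (fun j => smoothMA (fun k => fs k j) U) (μ.restrict U) U) ∧
  μ Ωᶜ = 0 ∧ ∀ K : Set (Hn n), IsCompact K → K ⊆ Ω → μ K < ⊤

/-- The mixed Monge–Ampère measure of locally bounded plurisubharmonic functions. -/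
def MAmix {n : ℕ} (Ω : Set (Hn n)) (us : Fin n → (Hn n → ℝ)) : Measure (Hn n) :=
  open Classical in
  if h : ∃ μ : Measure (Hn n), IsMixedMA Ω us μ then h.choose else 0

/-- The Monge–Ampère measure `(△u)ⁿ` of a locally bounded plurisubharmonic function. -/
def MAn {n : ℕ} (Ω : Set (Hn n)) (u : Hn n → ℝ) : Measure (Hn n) :=
  MAmix Ω fun _ => u

/-! ### The Cegrell classes -/

/-- Boundary limit zero. -/
def ZeroBdry {n : ℕ} (Ω : Set (Hn n)) (φ : Hn n → ℝ) : Prop :=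
  ∀ ζ ∈ frontier Ω, Tendsto φ (𝓝[Ω] ζ) (𝓝 0)

/-- The class `E₀(Ω)` of bounded negative plurisubharmonic functions with zero boundary
values and finite total Monge–Ampère mass. -/
def InE0 {n : ℕ} (Ω : Set (Hn n)) (φ : Hn n → ℝ) : Prop :=
  QPSHr φ Ω ∧ (∀ q ∈ Ω, φ q ≤ 0) ∧ (∃ M : ℝ, ∀ q ∈ Ω, |φ q| ≤ M) ∧
    ZeroBdry Ω φ ∧ MAn Ω φ Ω < ⊤

/-- `g` is a sequence decreasing pointwise on `Ω` to the `[-∞,∞)`-valued function `u`. -/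
def DecTo {n : ℕ} (Ω : Set (Hn n)) (g : ℕ → Hn n → ℝ) (u : Hn n → EReal) : Prop :=
  (∀ q ∈ Ω, Antitone fun j => g j q) ∧
  ∀ q ∈ Ω, Tendsto (fun j => ((g j q : ℝ) : EReal)) atTop (𝓝 (u q))

/-- The class `F(Ω)`. -/
def InF {n : ℕ} (Ω : Set (Hn n)) (u : Hn n → EReal) : Prop :=
  QPSH u Ω ∧ (∀ q ∈ Ω, u q ≤ 0) ∧
  ∃ g : ℕ → Hn n → ℝ, (∀ j, InE0 Ω (g j)) ∧ DecTo Ω g u ∧ (⨆ j, MAn Ω (g j) Ω) < ⊤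

/-- The class `E(Ω)`. -/
def InE {n : ℕ} (Ω : Set (Hn n)) (u : Hn n → EReal) : Prop :=
  QPSH u Ω ∧ (∀ q ∈ Ω, u q ≤ 0) ∧
  ∀ K : Set (Hn n), IsCompact K → K ⊆ Ω →
    ∃ uK : Hn n → EReal, InF Ω uK ∧ ∀ q ∈ K, uK q = u q

/-- The `p`-energy `∫_Ω (−φ)^p (△φ)ⁿ` of `φ ∈ E₀(Ω)`. -/
def energyP {n : ℕ} (Ω : Set (Hn n)) (p : ℝ) (φ : Hn n → ℝ) : ℝ≥0∞ :=
  ∫⁻ q in Ω, ENNReal.ofReal ((-φ q) ^ p) ∂(MAn Ω φ)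

/-- The mutual `p`-energy `∫_Ω (−φ₀)^p △φ₁∧…∧△φₙ`. -/
def mutualEnergyP {n : ℕ} (Ω : Set (Hn n)) (p : ℝ) (φ₀ : Hn n → ℝ)
    (φs : Fin n → (Hn n → ℝ)) : ℝ≥0∞ :=
  ∫⁻ q in Ω, ENNReal.ofReal ((-φ₀ q) ^ p) ∂(MAmix Ω φs)

/-- The class `E_p(Ω)`. -/
def InEp {n : ℕ} (Ω : Set (Hn n)) (p : ℝ) (u : Hn n → EReal) : Prop :=
  QPSH u Ω ∧ (∀ q ∈ Ω, u q ≤ 0) ∧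
  ∃ g : ℕ → Hn n → ℝ, (∀ j, InE0 Ω (g j)) ∧ DecTo Ω g u ∧ (⨆ j, energyP Ω p (g j)) < ⊤

/-! ### The Monge–Ampère operator on the Cegrell classes -/

/-- `μ` is the mixed Monge–Ampère measure `△u¹∧…∧△uⁿ` of functions of the Cegrell
classes: the weak limit on `Ω` of the Monge–Ampère measures of any sequences in `E₀(Ω)`
decreasing to the `us`. -/
def IsMAmixCl {n : ℕ} (Ω : Set (Hn n)) (us : Fin n → (Hn n → EReal))
    (μ : Measure (Hn n)) : Prop :=
  (∀ gs : Fin n → ℕ → (Hn n → ℝ), (∀ k j, InE0 Ω (gs k j)) →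
    (∀ k, DecTo Ω (gs k) (us k)) →
    TendstoWeaklyOn (fun j => MAmix Ω fun k => gs k j) μ Ω) ∧
  μ Ωᶜ = 0 ∧ ∀ K : Set (Hn n), IsCompact K → K ⊆ Ω → μ K < ⊤

/-- The mixed Monge–Ampère measure on the Cegrell classes. -/
def MAmixCl {n : ℕ} (Ω : Set (Hn n)) (us : Fin n → (Hn n → EReal)) : Measure (Hn n) :=
  open Classical in
  if h : ∃ μ : Measure (Hn n), IsMAmixCl Ω us μ then h.choose else 0

/-- The Monge–Ampère measure `(△u)ⁿ` on the Cegrell classes. -/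
def MAnCl {n : ℕ} (Ω : Set (Hn n)) (u : Hn n → EReal) : Measure (Hn n) :=
  MAmixCl Ω fun _ => u

/-- `(△u)ⁿ = μ` for `u` in a Cegrell class. -/
def IsMAnCl {n : ℕ} (Ω : Set (Hn n)) (u : Hn n → EReal) (μ : Measure (Hn n)) : Prop :=
  IsMAmixCl Ω (fun _ => u) μ

/-- The `[0,∞]`-valued part of an extended real number. -/
def erealToENN (x : EReal) : ℝ≥0∞ :=
  if x = ⊤ then ⊤ else ENNReal.ofReal x.toReal

/-- The quaternionic energy `E(u) = ∫_Ω (−u)(△u)ⁿ` of `u ∈ E₁(Ω)`. -/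
def energyCl {n : ℕ} (Ω : Set (Hn n)) (u : Hn n → EReal) : ℝ≥0∞ :=
  ∫⁻ q in Ω, erealToENN (-(u q)) ∂(MAnCl Ω u)

/-- A positive measure has finite quaternionic `1`-energy (`μ ∈ M₁`). -/
def InM1 {n : ℕ} (Ω : Set (Hn n)) (μ : Measure (Hn n)) : Prop :=
  ∃ C : ℝ, 0 < C ∧ ∀ u : Hn n → EReal, InEp Ω 1 u →
    (∫⁻ q in Ω, erealToENN (-(u q)) ∂μ) ≤
      ENNReal.ofReal C * (energyCl Ω u) ^ ((1 : ℝ) / (n + 1))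

/-- The energy functional `F_μ(u) = (1/(n+1)) E(u) + ∫_Ω u dμ`. -/
def energyFunc {n : ℕ} (Ω : Set (Hn n)) (μ : Measure (Hn n)) (u : Hn n → EReal) : ℝ :=
  (1 / (n + 1) : ℝ) * (energyCl Ω u).toReal - (∫⁻ q in Ω, erealToENN (-(u q)) ∂μ).toReal

/-- A positive Radon measure in `Ω`. -/
def RadonOn {n : ℕ} (μ : Measure (Hn n)) (Ω : Set (Hn n)) : Prop :=
  μ Ωᶜ = 0 ∧ ∀ K : Set (Hn n), IsCompact K → K ⊆ Ω → μ K < ⊤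

end

noncomputable section

/-- The relatively extremal function `u_{K,Ω}`. -/
def relExt {n : ℕ} (Ω K : Set (Hn n)) (q : Hn n) : EReal :=
  sSup {y : EReal | ∃ u : Hn n → EReal, QPSH u Ω ∧ (∀ x ∈ Ω, u x ≤ 0) ∧
    (∀ x ∈ K, u x ≤ -1) ∧ y = u q}

/-- The upper semicontinuous regularization of `u` on `Ω`. -/
def uscReg {n : ℕ} (u : Hn n → EReal) (Ω : Set (Hn n)) (x : Hn n) : EReal :=
  Filter.limsup u (𝓝[Ω] x)

/-! ### Harmonic perturbations and a maximum principle -/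

/-- Harmonicity is inherited by open subsets. -/
lemma HarmonicOnQ.mono {h : ℍ → ℝ} {s t : Set ℍ} (hh : HarmonicOnQ h s) (hts : t ⊆ s) :
    HarmonicOnQ h t :=
  ⟨hh.1.mono hts, fun x hx => hh.2 x (hts hx)⟩

/-- Scaling a harmonic function and adding an affine function preserves harmonicity. -/
lemma HarmonicOnQ.mul_add_affine {h : ℍ → ℝ} {s : Set ℍ} (hs : IsOpen s)
    (hh : HarmonicOnQ h s) (k : ℝ) (A : ℍ →L[ℝ] ℝ) (c : ℝ) :
    HarmonicOnQ (fun t => k * h t + (A t + c)) s := by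
  refine ⟨(contDiffOn_const.mul hh.1).add ((A.contDiff.add contDiff_const).contDiffOn), ?_⟩
  have hd : ∀ y ∈ s, DifferentiableAt ℝ h y := fun y hy =>
    (hh.1.differentiableOn (by norm_num)).differentiableAt (hs.mem_nhds hy)
  have key : ∀ x ∈ s, ∀ v, secondDeriv (fun t => k * h t + (A t + c)) x v =
      k * secondDeriv h x v := by
    intro x hx v
    have h1 : (fun y => fderiv ℝ (fun t => k * h t + (A t + c)) y v) =ᶠ[𝓝 x]
        fun y => A v + k • fderiv ℝ h y v := by
      filter_upwards [hs.mem_nhds hx] with y hy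
      have : HasFDerivAt (fun t => k * h t + (A t + c)) (k • fderiv ℝ h y + A) y :=
        ((hd y hy).hasFDerivAt.const_mul k).add (A.hasFDerivAt.add_const c)
      rw [this.fderiv]
      simp [add_comm]
    have h2 : DifferentiableAt ℝ (fun y => fderiv ℝ h y v) x := by
      have h3 : ContDiffAt ℝ 2 h x := hh.1.contDiffAt (hs.mem_nhds hx)
      have h4 : DifferentiableAt ℝ (fderiv ℝ h) x :=
        (h3.fderiv_right (m := 1) (by norm_num)).differentiableAt (by norm_num)
      exact h4.clm_apply (differentiableAt_const v)
    unfold secondDeriv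
    rw [h1.fderiv_eq]
    have h5 : HasFDerivAt (fun y => A v + k • fderiv ℝ h y v)
        (k • fderiv ℝ (fun y => fderiv ℝ h y v) x) x :=
      (h2.hasFDerivAt.const_smul k).const_add (A v)
    rw [h5.fderiv]
    rfl
  intro x hx
  have := hh.2 x hx
  unfold lapQ at this ⊢
  have e0 := key x hx 1
  have e1 := key x hx ⟨0, 1, 0, 0⟩
  have e2 := key x hx ⟨0, 0, 1, 0⟩
  have e3 := key x hx ⟨0, 0, 0, 1⟩
  linear_combination k * this + e0 + e1 + e2 + e3

lemma EReal.add_coe_le_coe_iff {x : EReal} {a b : ℝ} :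
    x + (a : EReal) ≤ (b : EReal) ↔ x ≤ ((b - a : ℝ) : EReal) := by
  induction x using EReal.rec with
  | bot => simp
  | top => simp [-EReal.coe_sub]
  | coe x =>
    norm_cast
    constructor <;> intro h <;> linarith

/-- Adding a continuous real-valued function preserves upper semicontinuity. -/
lemma UpperSemicontinuousOn.add_coe {X : Type*} [TopologicalSpace X] {v : X → EReal}
    {f : X → ℝ} {C : Set X} (hv : UpperSemicontinuousOn v C) (hf : ContinuousOn f C) :
    UpperSemicontinuousOn (fun t => v t + (f t : EReal)) C := by
  refine hv.add' ?_ ?_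
  · exact (continuous_coe_real_ereal.comp_continuousOn hf).upperSemicontinuousOn
  · intro x _
    exact EReal.continuousAt_add (Or.inr (by simp)) (Or.inr (by simp))

/-- Maximum principle: an upper semicontinuous function which is subharmonic (in the sense of
harmonic majorants on small balls) in an open set `O` and lies below `h` on `C \ O`
lies below `h` on the compact set `C ⊇ O`, for `h` harmonic in `O`. -/
lemma le_of_harmonic_majorant {v : ℍ → EReal} {h : ℍ → ℝ} {C O : Set ℍ} (hC : IsCompact C)
    (hO : IsOpen O) (hOC : O ⊆ C) (hv : UpperSemicontinuousOn v C) (vtop : ∀ t ∈ C, v t ≠ ⊤)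
    (hh : ContinuousOn h C) (hhO : HarmonicOnQ h O)
    (hsub : ∀ p s, 0 < s → Metric.closedBall p s ⊆ O → ∀ g : ℍ → ℝ,
      ContinuousOn g (Metric.closedBall p s) → HarmonicOnQ g (Metric.ball p s) →
      (∀ y ∈ Metric.sphere p s, v y ≤ (g y : EReal)) → v p ≤ (g p : EReal))
    (hb : ∀ t ∈ C \ O, v t ≤ (h t : EReal)) : ∀ t ∈ C, v t ≤ (h t : EReal) := by
  intro p₀ hp₀
  by_contra hcon
  push Not at hcon
  obtain ⟨m, hm1, hm2⟩ := EReal.lt_iff_exists_real_btwn.1 hcon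
  have hm1' : h p₀ < m := by exact_mod_cast hm1
  obtain ⟨R, hR0, hR⟩ : ∃ R : ℝ, 0 < R ∧ ∀ t ∈ C, ‖t‖ ^ 2 ≤ R := by
    obtain ⟨r, hr0, hr⟩ := hC.isBounded.exists_pos_norm_le
    exact ⟨r ^ 2, by positivity, fun t ht => by
      have := hr t ht
      gcongr⟩
  obtain ⟨η, hη0, hη⟩ : ∃ η : ℝ, 0 < η ∧ ∀ t ∈ C, η * ‖t‖ ^ 2 ≤ (m - h p₀) / 2 := by
    refine ⟨(m - h p₀) / 2 / R, by have := sub_pos.2 hm1'; positivity, fun t ht => ?_⟩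
    have h1 : 0 < (m - h p₀) / 2 := by linarith
    calc (m - h p₀) / 2 / R * ‖t‖ ^ 2 ≤ (m - h p₀) / 2 / R * R := by
          gcongr
          exact hR t ht
      _ = _ := by field_simp
  have hφ : UpperSemicontinuousOn (fun t => v t + ((η * ‖t‖ ^ 2 - h t : ℝ) : EReal)) C :=
    hv.add_coe (ContinuousOn.sub (by fun_prop) hh)
  obtain ⟨p, hpC, hp⟩ := hφ.exists_isMaxOn ⟨p₀, hp₀⟩ hC
  have hlow : ((m - h p₀ : ℝ) : EReal) ≤ v p + ((η * ‖p‖ ^ 2 - h p : ℝ) : EReal) := by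
    refine le_trans ?_ (hp hp₀)
    calc ((m - h p₀ : ℝ) : EReal) ≤ ((m + (η * ‖p₀‖ ^ 2 - h p₀) : ℝ) : EReal) := by
          norm_cast
          have : 0 ≤ η * ‖p₀‖ ^ 2 := by positivity
          linarith
      _ = (m : EReal) + ((η * ‖p₀‖ ^ 2 - h p₀ : ℝ) : EReal) := EReal.coe_add _ _
      _ ≤ _ := by
          show _ ≤ v p₀ + _
          exact add_le_add hm2.le le_rfl
  have hvtop := vtop p hpC
  obtain ⟨r, hr⟩ : ∃ r : ℝ, v p = r := by
    refine ⟨(v p).toReal, (EReal.coe_toReal hvtop ?_).symm⟩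
    intro hbot
    rw [hbot, EReal.bot_add, le_bot_iff] at hlow
    exact EReal.coe_ne_bot _ hlow
  have hlow' : m - h p₀ ≤ r + (η * ‖p‖ ^ 2 - h p) := by
    rw [hr] at hlow
    exact_mod_cast hlow
  have hpO : p ∈ O := by
    by_contra hpO
    have h1 := hb p ⟨hpC, hpO⟩
    rw [hr] at h1
    have h2 : r ≤ h p := by exact_mod_cast h1
    have := hη p hpC
    linarith
  obtain ⟨s, hs0, hs⟩ := Metric.nhds_basis_closedBall.mem_iff.1 (hO.mem_nhds hpO)
  let A : ℍ →L[ℝ] ℝ := (-(2 * η)) • innerSL ℝ p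
  let c : ℝ := η * ‖p‖ ^ 2 - η * s ^ 2 + (r + η * ‖p‖ ^ 2 - h p)
  have hg := hsub p s hs0 hs (fun t => 1 * h t + (A t + c))
    (ContinuousOn.add (continuousOn_const.mul (hh.mono (hs.trans hOC))) (by fun_prop))
    ((hhO.mono (Metric.ball_subset_closedBall.trans hs)).mul_add_affine Metric.isOpen_ball 1 A c)
    (by
      intro t ht
      have htC : t ∈ C := hOC (hs (Metric.sphere_subset_closedBall ht))
      have h1 : v t + ((η * ‖t‖ ^ 2 - h t : ℝ) : EReal) ≤
          ((r + (η * ‖p‖ ^ 2 - h p) : ℝ) : EReal) := by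
        have := hp htC
        simp only [Set.mem_ofPred_eq, hr] at this
        rwa [EReal.coe_add]
      refine (EReal.add_coe_le_coe_iff.1 h1).trans (EReal.coe_le_coe_iff.2 (le_of_eq ?_))
      have h2 : ‖t - p‖ = s := by rw [← dist_eq_norm]; exact ht
      have h3 := norm_sub_sq_real t p
      rw [h2, real_inner_comm] at h3
      simp only [A, c, _root_.smul_apply, innerSL_apply_apply, smul_eq_mul]
      linear_combination η * h3)
  rw [hr] at hg
  have h4 : r ≤ 1 * h p + (A p + c) := by exact_mod_cast hg
  simp only [A, c, _root_.smul_apply, innerSL_apply_apply, smul_eq_mul,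
    real_inner_self_eq_norm_sq] at h4
  have : 0 < η * s ^ 2 := by positivity
  linarith

/-! ### Plurisubharmonic functions -/

lemma continuous_qLine {n : ℕ} : Continuous fun z : (Hn n × Hn n) × ℍ => qLine z.1.1 z.1.2 z.2 := by
  unfold qLine
  fun_prop

lemma continuous_qLine_right {n : ℕ} (a b : Hn n) : Continuous (qLine a b) := by
  unfold qLine
  fun_prop

lemma qLine_add_left {n : ℕ} (a b e : Hn n) (t : ℍ) : qLine (a + e) b t = qLine a b t + e := by
  funext k
  simp only [qLine, Pi.add_apply]
  abel

/-- For plurisubharmonicity only the harmonic majorant property on lines has to be checked. -/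
lemma QPSH.of_majorant {n : ℕ} {u : Hn n → EReal} {Ω : Set (Hn n)}
    (husc : UpperSemicontinuousOn u Ω) (htop : ∀ q ∈ Ω, u q ≠ ⊤)
    (hmaj : ∀ (a b : Hn n) (x : ℍ) (r : ℝ), 0 < r →
      (∀ t ∈ Metric.closedBall x r, qLine a b t ∈ Ω) →
      ∀ h : ℍ → ℝ, ContinuousOn h (Metric.closedBall x r) → HarmonicOnQ h (Metric.ball x r) →
      (∀ t ∈ Metric.sphere x r, u (qLine a b t) ≤ (h t : EReal)) →
      ∀ t ∈ Metric.closedBall x r, u (qLine a b t) ≤ (h t : EReal)) : QPSH u Ω :=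
  ⟨husc, htop, fun a b =>
    ⟨husc.comp (continuous_qLine_right a b).continuousOn fun _ ht => ht,
      fun _ ht => htop _ ht, fun x r hr hsub => hmaj a b x r hr hsub⟩⟩

lemma QPSH.majorant {n : ℕ} {u : Hn n → EReal} {Ω : Set (Hn n)} (hu : QPSH u Ω) (a b : Hn n)
    {x : ℍ} {r : ℝ} (hr : 0 < r) (hΩ : ∀ t ∈ Metric.closedBall x r, qLine a b t ∈ Ω)
    {h : ℍ → ℝ} (hc : ContinuousOn h (Metric.closedBall x r))
    (hh : HarmonicOnQ h (Metric.ball x r))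
    (hb : ∀ t ∈ Metric.sphere x r, u (qLine a b t) ≤ (h t : EReal)) :
    ∀ t ∈ Metric.closedBall x r, u (qLine a b t) ≤ (h t : EReal) :=
  (hu.2.2 a b).2.2 x r hr hΩ h hc hh hb

lemma QPSH.isOpen_sublevel {n : ℕ} {u : Hn n → EReal} {Ω : Set (Hn n)} (hu : QPSH u Ω)
    (hΩ : IsOpen Ω) (c : EReal) : IsOpen {q | q ∈ Ω ∧ u q < c} := by
  refine isOpen_iff_mem_nhds.2 fun q hq => ?_
  have h1 := hu.1 q hq.1 c hq.2
  rw [hΩ.nhdsWithin_eq hq.1] at h1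
  exact inter_mem (hΩ.mem_nhds hq.1) h1

lemma EReal.coe_mul_le_coe_iff {M : ℝ} (hM : 0 < M) {x : EReal} {b : ℝ} :
    (M : EReal) * x ≤ (b : EReal) ↔ x ≤ ((M⁻¹ * b : ℝ) : EReal) := by
  induction x using EReal.rec with
  | bot => simp [EReal.coe_mul_bot_of_pos hM]
  | top => simp [EReal.coe_mul_top_of_pos hM, -EReal.coe_mul]
  | coe x =>
    norm_cast
    rw [inv_mul_eq_div, le_div_iff₀' hM]

lemma EReal.coe_mul_lt_coe_iff {M : ℝ} (hM : 0 < M) {x : EReal} {b : ℝ} :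
    (M : EReal) * x < (b : EReal) ↔ x < ((M⁻¹ * b : ℝ) : EReal) := by
  induction x using EReal.rec with
  | bot => simp [EReal.coe_mul_bot_of_pos hM, EReal.bot_lt_coe, -EReal.coe_mul]
  | top => simp [EReal.coe_mul_top_of_pos hM, -EReal.coe_mul]
  | coe x =>
    norm_cast
    rw [inv_mul_eq_div, lt_div_iff₀' hM]

/-- Positive multiples of plurisubharmonic functions are plurisubharmonic. -/
lemma QPSH.const_mul {n : ℕ} {u : Hn n → EReal} {Ω : Set (Hn n)} (hu : QPSH u Ω)
    {M : ℝ} (hM : 0 < M) : QPSH (fun q => (M : EReal) * u q) Ω := by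
  refine QPSH.of_majorant ?_ ?_ ?_
  · intro q hq y hy
    obtain ⟨c, hc1, hc2⟩ := EReal.lt_iff_exists_real_btwn.1 hy
    filter_upwards [hu.1 q hq _ ((EReal.coe_mul_lt_coe_iff hM).1 hc1)] with q' hq'
    exact ((EReal.coe_mul_lt_coe_iff hM).2 hq').trans hc2
  · intro q hq
    have := hu.2.1 q hq
    generalize u q = x at this ⊢
    induction x using EReal.rec with
    | bot => simp [EReal.coe_mul_bot_of_pos hM]
    | top => exact absurd rfl this
    | coe x => exact_mod_cast EReal.coe_ne_top (M * x)
  · intro a b x r hr hΩ h hc hh hb t ht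
    rw [EReal.coe_mul_le_coe_iff hM]
    have := hu.majorant a b hr hΩ (h := fun t => M⁻¹ * h t + ((0 : ℍ →L[ℝ] ℝ) t + 0))
      (ContinuousOn.add (continuousOn_const.mul hc) (by fun_prop))
      (hh.mul_add_affine Metric.isOpen_ball _ _ _)
      (fun y hy => by simpa using (EReal.coe_mul_le_coe_iff hM).1 (hb y hy)) t ht
    simpa using this

/-! ### The upper semicontinuous regularization -/

lemma eventually_lt_of_uscReg_lt {n : ℕ} {u : Hn n → EReal} {Ω : Set (Hn n)} {x : Hn n}
    {c : EReal} (h : uscReg u Ω x < c) : ∀ᶠ q in 𝓝[Ω] x, u q < c :=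
  eventually_lt_of_limsup_lt h

lemma uscReg_le {n : ℕ} {u : Hn n → EReal} {Ω : Set (Hn n)} {x : Hn n}
    {c : EReal} (h : ∀ᶠ q in 𝓝[Ω] x, u q ≤ c) : uscReg u Ω x ≤ c :=
  limsup_le_of_le (by isBoundedDefault) h

lemma le_uscReg {n : ℕ} {u : Hn n → EReal} {Ω : Set (Hn n)} {x : Hn n} (hx : x ∈ Ω) :
    u x ≤ uscReg u Ω x := by
  refine le_of_forall_gt fun c hc => ?_
  exact (eventually_lt_of_uscReg_lt hc).self_of_nhdsWithin hx

lemma upperSemicontinuousOn_uscReg {n : ℕ} (u : Hn n → EReal) (Ω : Set (Hn n)) :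
    UpperSemicontinuousOn (uscReg u Ω) Ω := by
  intro x _ c hc
  obtain ⟨d, hd1, hd2⟩ := exists_between hc
  filter_upwards [eventually_eventually_nhdsWithin.2 (eventually_lt_of_uscReg_lt hd1)] with q hq
  exact (uscReg_le (hq.mono fun _ => le_of_lt)).trans_lt hd2

/-- Competitors for the relatively extremal function lie below it. -/
lemma le_relExt {n : ℕ} {Ω K : Set (Hn n)} {u : Hn n → EReal} (hu : QPSH u Ω)
    (h0 : ∀ x ∈ Ω, u x ≤ 0) (h1 : ∀ x ∈ K, u x ≤ -1) (q : Hn n) : u q ≤ relExt Ω K q :=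
  le_sSup ⟨u, hu, h0, h1, rfl⟩

lemma relExt_le {n : ℕ} {Ω K : Set (Hn n)} {q : Hn n} {c : EReal}
    (h : ∀ u : Hn n → EReal, QPSH u Ω → (∀ x ∈ Ω, u x ≤ 0) → (∀ x ∈ K, u x ≤ -1) → u q ≤ c) :
    relExt Ω K q ≤ c := by
  refine sSup_le ?_
  rintro _ ⟨u, hu, h0, h1, rfl⟩
  exact h u hu h0 h1

lemma relExt_nonpos {n : ℕ} {Ω K : Set (Hn n)} {q : Hn n} (hq : q ∈ Ω) : relExt Ω K q ≤ 0 :=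
  relExt_le fun _ _ h0 _ => h0 q hq

lemma uscReg_relExt_nonpos {n : ℕ} {Ω K : Set (Hn n)} (q : Hn n) :
    uscReg (relExt Ω K) Ω q ≤ 0 :=
  uscReg_le (eventually_nhdsWithin_of_forall fun _ => relExt_nonpos)

/-- The regularized relatively extremal function is plurisubharmonic. -/
lemma qpsh_uscReg_relExt {n : ℕ} {Ω : Set (Hn n)} (hΩ : IsOpen Ω) (K : Set (Hn n)) :
    QPSH (uscReg (relExt Ω K) Ω) Ω := by
  have husc := upperSemicontinuousOn_uscReg (relExt Ω K) Ω
  refine QPSH.of_majorant husc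
    (fun q _ => ((uscReg_relExt_nonpos q).trans_lt EReal.zero_lt_top).ne) ?_
  intro a b x r hr hin h hc hh hb y hy
  refine EReal.le_of_forall_lt_iff_le.1 fun z hz => ?_
  have hε : 0 < z - h y := by
    have : h y < z := by exact_mod_cast hz
    linarith
  have hball : ∀ᶠ e in 𝓝 (0 : Hn n), ∀ t ∈ Metric.closedBall x r, qLine a b t + e ∈ Ω := by
    refine (isCompact_closedBall x r).eventually_forall_of_forall_eventually fun t ht => ?_
    have hcont : Continuous fun z : Hn n × ℍ => qLine a b z.2 + z.1 :=
      ((continuous_qLine_right a b).comp continuous_snd).add continuous_fst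
    refine hcont.continuousAt.eventually (hΩ.mem_nhds ?_)
    simpa using hin t ht
  have hsph : ∀ᶠ e in 𝓝 (0 : Hn n), ∀ t ∈ Metric.sphere x r,
      relExt Ω K (qLine a b t + e) ≤ ((h t + (z - h y) : ℝ) : EReal) := by
    have hP : ∀ᶠ e in 𝓝 (0 : Hn n), ∀ t ∈ Metric.sphere x r, t ∈ Metric.closedBall x r →
        relExt Ω K (qLine a b t + e) ≤ ((h t + (z - h y) : ℝ) : EReal) := by
      refine (isCompact_sphere x r).eventually_forall_of_forall_eventually fun t ht => ?_
      have htB := Metric.sphere_subset_closedBall ht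
      have hlt : uscReg (relExt Ω K) Ω (qLine a b t) < ((h t + (z - h y) / 2 : ℝ) : EReal) :=
        (hb t ht).trans_lt (EReal.coe_lt_coe_iff.2 (by linarith))
      have hev := husc _ (hin t htB) _ hlt
      rw [hΩ.nhdsWithin_eq (hin t htB)] at hev
      have hcont : Continuous fun z : Hn n × ℍ => qLine a b z.2 + z.1 :=
        ((continuous_qLine_right a b).comp continuous_snd).add continuous_fst
      have hlim : Tendsto (fun z : Hn n × ℍ => qLine a b z.2 + z.1) (𝓝 (0, t))
          (𝓝 (qLine a b t)) := by
        simpa using hcont.tendsto (0, t)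
      have h1 := hlim.eventually (hev.and (hΩ.mem_nhds (hin t htB)))
      have h2 : ∀ᶠ t' in 𝓝 t, t' ∈ Metric.closedBall x r → h t - (z - h y) / 2 < h t' :=
        eventually_nhdsWithin_iff.1 ((hc t htB).eventually (lt_mem_nhds (by linarith)))
      filter_upwards [h1, (continuous_snd.tendsto ((0 : Hn n), t)).eventually h2]
        with w hw1 hw2 hwB
      have := hw2 hwB
      exact (le_uscReg hw1.2).trans (hw1.1.le.trans (EReal.coe_le_coe_iff.2 (by linarith)))
    filter_upwards [hP] with e he t ht using he t ht (Metric.sphere_subset_closedBall ht)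
  refine uscReg_le ?_
  have hshift : Tendsto (fun q => q - qLine a b y) (𝓝[Ω] (qLine a b y)) (𝓝 0) := by
    have : Continuous fun q => q - qLine a b y := by fun_prop
    simpa using (this.tendsto (qLine a b y)).mono_left nhdsWithin_le_nhds
  filter_upwards [hshift.eventually hball, hshift.eventually hsph] with q h1 h2
  set e := q - qLine a b y
  refine relExt_le fun u hu h0 hK => ?_
  have := hu.majorant (a + e) b hr (by simpa only [qLine_add_left] using h1)
    (h := fun t => 1 * h t + ((0 : ℍ →L[ℝ] ℝ) t + (z - h y)))
    (ContinuousOn.add (continuousOn_const.mul hc) (by fun_prop))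
    (hh.mul_add_affine Metric.isOpen_ball _ _ _)
    (fun t ht => by
      rw [qLine_add_left]
      refine (le_relExt hu h0 hK _).trans ((h2 t ht).trans (le_of_eq ?_))
      simp) y hy
  rw [qLine_add_left] at this
  simpa [e, -EReal.coe_sub] using this

/-! ### Gluing with translates -/

/-- If `u ≤ 0` is plurisubharmonic and `{u < -ε}` is relatively compact, then `u` may be glued
with the small translate `u (· + e) - ε`. -/
lemma QPSH.glue_translate {n : ℕ} {Ω : Set (Hn n)} (hΩ : IsOpen Ω) {u : Hn n → EReal}
    (hu : QPSH u Ω) (h0 : ∀ q ∈ Ω, u q ≤ 0) {ε : ℝ} {L : Set (Hn n)} (hL : IsClosed L)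
    (huL : {q | q ∈ Ω ∧ u q < ((-ε : ℝ) : EReal)} ⊆ L) {e : Hn n}
    (he : ∀ q ∈ L, q + e ∈ Ω) :
    QPSH (open Classical in fun q =>
      if q ∈ L then max (u q) (u (q + e) + ((-ε : ℝ) : EReal)) else u q) Ω := by
  classical
  set w : Hn n → EReal := fun q =>
    if q ∈ L then max (u q) (u (q + e) + ((-ε : ℝ) : EReal)) else u q with hw
  have hwL : ∀ q ∈ L, w q = max (u q) (u (q + e) + ((-ε : ℝ) : EReal)) := fun q hq => if_pos hq
  have hwL' : ∀ q, q ∉ L → w q = u q := fun q hq => if_neg hq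
  have huw : ∀ q, u q ≤ w q := fun q => by
    by_cases hq : q ∈ L
    · rw [hwL q hq]; exact le_max_left _ _
    · rw [hwL' q hq]
  have hv : UpperSemicontinuousOn (fun q => u (q + e) + ((-ε : ℝ) : EReal))
      {q | q + e ∈ Ω} :=
    (hu.1.comp (g := fun q => q + e) (by fun_prop) fun _ hq => hq).add_coe continuousOn_const
  have hvtop : ∀ q, q + e ∈ Ω → u (q + e) + ((-ε : ℝ) : EReal) ≠ ⊤ := fun q hq =>
    EReal.add_ne_top (hu.2.1 _ hq) (EReal.coe_ne_top _)
  have hvε : ∀ q, q + e ∈ Ω → u (q + e) + ((-ε : ℝ) : EReal) ≤ ((-ε : ℝ) : EReal) := fun q hq =>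
    (add_le_add (h0 _ hq) le_rfl).trans (zero_add _).le
  have hD : IsOpen {q : Hn n | q + e ∈ Ω} := hΩ.preimage (by fun_prop)
  have hW : IsOpen {q | q ∈ Ω ∧ u q < ((-ε : ℝ) : EReal)} :=
    hu.isOpen_sublevel hΩ _
  refine QPSH.of_majorant ?_ ?_ ?_
  · intro q hq c hc
    have h1 := hu.1 q hq c ((huw q).trans_lt hc)
    by_cases hqL : q ∈ L
    · rw [hwL q hqL] at hc
      have h2 := hv q (he q hqL) c ((le_max_right _ _).trans_lt hc)
      rw [hD.nhdsWithin_eq (he q hqL)] at h2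
      filter_upwards [h1, mem_nhdsWithin_of_mem_nhds h2] with q' h1' h2'
      by_cases hq' : q' ∈ L
      · rw [hwL q' hq']; exact max_lt h1' h2'
      · rwa [hwL' q' hq']
    · filter_upwards [h1, mem_nhdsWithin_of_mem_nhds (hL.isOpen_compl.mem_nhds hqL)]
        with q' h1' h2'
      rwa [hwL' q' h2']
  · intro q hq
    by_cases hqL : q ∈ L
    · rw [hwL q hqL]
      rcases max_choice (u q) (u (q + e) + ((-ε : ℝ) : EReal)) with h | h <;> rw [h]
      · exact hu.2.1 q hq
      · exact hvtop q (he q hqL)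
    · rw [hwL' q hqL]; exact hu.2.1 q hq
  · intro a b x r hr hin h hc hh hb
    have hle := hu.majorant a b hr hin hc hh fun t ht => (huw _).trans (hb t ht)
    have hcl := continuous_qLine_right a b
    have hCmem : ∀ t ∈ Metric.closedBall x r ∩ qLine a b ⁻¹' L, qLine a b t + e ∈ Ω :=
      fun t ht => he _ ht.2
    have hmax := le_of_harmonic_majorant (h := h)
      (v := fun t => u (qLine a b t + e) + ((-ε : ℝ) : EReal))
      (C := Metric.closedBall x r ∩ qLine a b ⁻¹' L)
      (O := Metric.ball x r ∩ qLine a b ⁻¹' {q | q ∈ Ω ∧ u q < ((-ε : ℝ) : EReal)})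
      ((isCompact_closedBall x r).inter_right (hL.preimage hcl))
      (Metric.isOpen_ball.inter (hW.preimage hcl))
      (Set.inter_subset_inter Metric.ball_subset_closedBall (Set.preimage_mono huL))
      (hv.comp hcl.continuousOn hCmem) (fun t ht => hvtop _ (hCmem t ht))
      (hc.mono Set.inter_subset_left) (hh.mono Set.inter_subset_left)
      (by
        intro p s hs hsub g hg hgh hgb
        have := hu.majorant (a + e) b hs (x := p)
          (h := fun t => 1 * g t + ((0 : ℍ →L[ℝ] ℝ) t + ε))
          (fun t ht => by
            rw [qLine_add_left]
            exact he _ (huL (hsub ht).2))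
          (ContinuousOn.add (continuousOn_const.mul hg) (by fun_prop))
          (hgh.mul_add_affine Metric.isOpen_ball _ _ _)
          (fun t ht => by
            rw [qLine_add_left]
            refine (EReal.add_coe_le_coe_iff.1 (hgb t ht)).trans
              (EReal.coe_le_coe_iff.2 (le_of_eq ?_))
            simp) p (Metric.mem_closedBall_self hs.le)
        rw [qLine_add_left] at this
        refine EReal.add_coe_le_coe_iff.2 (this.trans (EReal.coe_le_coe_iff.2 (le_of_eq ?_)))
        simp)
      (by
        rintro t ⟨htC, htO⟩
        by_cases htb : t ∈ Metric.ball x r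
        · have h1 : ((-ε : ℝ) : EReal) ≤ u (qLine a b t) := by
            by_contra hlt
            exact htO ⟨htb, hin t htC.1, not_le.1 hlt⟩
          exact (hvε _ (hCmem t htC)).trans (h1.trans (hle t htC.1))
        · have hts : t ∈ Metric.sphere x r := by
            rw [Metric.mem_ball, not_lt] at htb
            exact le_antisymm htC.1 htb
          refine le_trans ?_ (hb t hts)
          rw [hwL _ htC.2]
          exact le_max_right _ _)
    intro t ht
    by_cases htL : qLine a b t ∈ L
    · rw [hwL _ htL]
      exact max_le (hle t ht) (hmax t ⟨ht, htL⟩)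
    · rw [hwL' _ htL]
      exact hle t ht

/-- In a hyperconvex domain the sublevel sets of the relatively extremal function of a compact
set are relatively compact. -/
lemma exists_isCompact_relExt_sublevel {n : ℕ} {Ω K : Set (Hn n)} (hΩ : QHyperconvex Ω)
    (hK : IsCompact K) (hKΩ : K ⊆ Ω) {ε : ℝ} (hε : 0 < ε) :
    ∃ L : Set (Hn n), IsCompact L ∧ L ⊆ Ω ∧
      {q | q ∈ Ω ∧ relExt Ω K q < ((-ε : ℝ) : EReal)} ⊆ L := by
  obtain ⟨-, -, -, ρ, hρ, hρ0, hρc⟩ := hΩ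
  obtain ⟨c, hc0, hc⟩ : ∃ c : ℝ, 0 < c ∧ ∀ q ∈ K, ρ q ≤ ((-c : ℝ) : EReal) := by
    rcases K.eq_empty_or_nonempty with rfl | hne
    · exact ⟨1, one_pos, by simp⟩
    · obtain ⟨p, hpK, hp⟩ := (hρ.1.mono hKΩ).exists_isMaxOn hne hK
      obtain ⟨d, hd1, hd2⟩ := EReal.lt_iff_exists_real_btwn.1 (hρ0 p (hKΩ hpK))
      have hd0 : d < 0 := by exact_mod_cast hd2
      refine ⟨-d, by linarith, fun q hq => ?_⟩
      rw [neg_neg]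
      exact (hp hq).trans hd1.le
  have hM : (0 : ℝ) < c⁻¹ := inv_pos.2 hc0
  have hle : ∀ q, ((c⁻¹ : ℝ) : EReal) * ρ q ≤ relExt Ω K q := by
    refine le_relExt (hρ.const_mul hM) (fun q hq => ?_) fun q hq => ?_
    · have := (EReal.coe_mul_le_coe_iff hM (x := ρ q) (b := 0)).2 (by
        simpa using (hρ0 q hq).le)
      simpa using this
    · have := (EReal.coe_mul_le_coe_iff hM (x := ρ q) (b := -1)).2 (by
        simpa using hc q hq)
      simpa using this
  obtain ⟨h1, h2⟩ := hρc (-(c * ε)) (by have := mul_pos hc0 hε; linarith)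
  refine ⟨_, h1, h2, fun q hq => subset_closure ⟨hq.1, ?_⟩⟩
  have := (EReal.coe_mul_lt_coe_iff hM).1 ((hle q).trans_lt hq.2)
  rwa [inv_inv, mul_neg] at this

/-- A uniform modulus of continuity for the relatively extremal function of a regular compact
set. -/
lemma exists_relExt_add_le {n : ℕ} {Ω K : Set (Hn n)} (hΩ : QHyperconvex Ω) (hK : IsCompact K)
    (hKΩ : K ⊆ Ω) (hu : QPSH (relExt Ω K) Ω) (huK : ∀ q ∈ K, relExt Ω K q ≤ -1)
    {ε : ℝ} (hε : 0 < ε) :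
    ∃ δ : ℝ, 0 < δ ∧ ∀ e : Hn n, ‖e‖ < δ → ∀ q ∈ Ω, q + e ∈ Ω →
      relExt Ω K (q + e) + ((-ε : ℝ) : EReal) ≤ relExt Ω K q := by
  classical
  obtain ⟨L, hLc, hLΩ, huL⟩ := exists_isCompact_relExt_sublevel hΩ hK hKΩ hε
  have hV : IsOpen {q | q ∈ Ω ∧ relExt Ω K q < ((-1 + ε : ℝ) : EReal)} :=
    hu.isOpen_sublevel hΩ.1 _
  have hKV : K ⊆ {q | q ∈ Ω ∧ relExt Ω K q < ((-1 + ε : ℝ) : EReal)} := fun q hq =>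
    ⟨hKΩ hq, (huK q hq).trans_lt (by
      have : ((-1 : ℝ) : EReal) < ((-1 + ε : ℝ) : EReal) := EReal.coe_lt_coe_iff.2 (by linarith)
      simpa using this)⟩
  obtain ⟨δ₁, hδ₁, h₁⟩ := hLc.exists_thickening_subset_open hΩ.1 hLΩ
  obtain ⟨δ₂, hδ₂, h₂⟩ := hK.exists_thickening_subset_open hV hKV
  have hthick : ∀ {S : Set (Hn n)} {δ : ℝ} {q e : Hn n}, q ∈ S → ‖e‖ < δ →
      q + e ∈ Metric.thickening δ S := fun {S δ q e} hq he =>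
    Metric.mem_thickening_iff.2 ⟨q, hq, by simpa [dist_eq_norm] using he⟩
  refine ⟨min δ₁ δ₂, lt_min hδ₁ hδ₂, fun e he q hq hqe => ?_⟩
  have heL : ∀ q ∈ L, q + e ∈ Ω := fun q hq => h₁ (hthick hq (he.trans_le (min_le_left _ _)))
  have hglue := hu.glue_translate hΩ.1 (fun q => relExt_nonpos) hLc.isClosed huL heL
  have hvε : ∀ q, q + e ∈ Ω → relExt Ω K (q + e) + ((-ε : ℝ) : EReal) ≤ ((-ε : ℝ) : EReal) :=
    fun q hq => (add_le_add (relExt_nonpos hq) le_rfl).trans (zero_add _).le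
  by_cases hqL : q ∈ L
  · have hle := le_relExt (K := K) hglue
      (fun p hp => by
        split_ifs with hpL
        · exact max_le (relExt_nonpos hp)
            ((hvε p (heL p hpL)).trans (by exact_mod_cast (neg_neg_of_pos hε).le))
        · exact relExt_nonpos hp)
      (fun p hp => by
        split_ifs with hpL
        · refine max_le (huK p hp) ?_
          have h3 := (h₂ (hthick hp (he.trans_le (min_le_right _ _)))).2.le
          have : relExt Ω K (p + e) + ((-ε : ℝ) : EReal) ≤ ((-1 : ℝ) : EReal) :=
            EReal.add_coe_le_coe_iff.2 (by rwa [sub_neg_eq_add])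
          simpa using this
        · exact huK p hp) q
    rw [if_pos hqL] at hle
    exact (le_max_right _ _).trans hle
  · refine (hvε q hqe).trans ?_
    by_contra hlt
    exact hqL (huL ⟨hq, not_le.1 hlt⟩)

/-- **Lemma 3.1.**  If `K ⊆ Ω` is compact and `u*_{K,Ω} ≡ −1` on `K`, then `u_{K,Ω}` is
continuous in `Ω`. -/
theorem relExt_continuousOn {n : ℕ} (Ω K : Set (Hn n)) (hΩ : QHyperconvex Ω)
    (hK : IsCompact K) (hKΩ : K ⊆ Ω)
    (hreg : ∀ q ∈ K, uscReg (relExt Ω K) Ω q = -1) :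
    ContinuousOn (relExt Ω K) Ω := by
  have hP := qpsh_uscReg_relExt hΩ.1 K
  have heq : ∀ q ∈ Ω, uscReg (relExt Ω K) Ω q = relExt Ω K q := fun q hq =>
    le_antisymm
      (le_relExt hP (fun p _ => uscReg_relExt_nonpos p) (fun p hp => (hreg p hp).le) q)
      (le_uscReg hq)
  have huK : ∀ q ∈ K, relExt Ω K q ≤ -1 := fun q hq => (heq q (hKΩ hq) ▸ hreg q hq).le
  have hu : QPSH (relExt Ω K) Ω := by
    refine QPSH.of_majorant (fun q hq c hc => ?_) (fun q hq => ?_) ?_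
    · exact eventually_lt_of_uscReg_lt ((heq q hq).trans_lt hc)
    · exact ((relExt_nonpos hq).trans_lt EReal.zero_lt_top).ne
    · intro a b x r hr hin h hc hh hb t ht
      rw [← heq _ (hin t ht)]
      exact hP.majorant a b hr hin hc hh
        (fun y hy => (heq _ (hin y (Metric.sphere_subset_closedBall hy))).trans_le (hb y hy)) t ht
  intro q hq
  refine tendsto_order.2 ⟨fun c hc => ?_, fun c hc => hu.1 q hq c hc⟩
  obtain ⟨d, hd1, hd2⟩ := EReal.lt_iff_exists_real_btwn.1 hc
  obtain ⟨m, hm1, hm2⟩ := EReal.lt_iff_exists_real_btwn.1 hd2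
  have hdm : d < m := by exact_mod_cast hm1
  obtain ⟨δ, hδ, hmod⟩ := exists_relExt_add_le hΩ hK hKΩ hu huK (sub_pos.2 hdm)
  filter_upwards [self_mem_nhdsWithin, mem_nhdsWithin_of_mem_nhds (Metric.ball_mem_nhds q hδ)]
    with p hp hpq
  have h1 := hmod (q - p) (by rwa [← dist_eq_norm, dist_comm]) p hp (by simpa using hq)
  rw [add_sub_cancel] at h1
  refine hd1.trans_le (le_trans ?_ h1)
  calc (d : EReal) = (m : EReal) + ((-(m - d) : ℝ) : EReal) := by
        rw [← EReal.coe_add]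
        congr 1
        ring
    _ ≤ _ := add_le_add hm2.le le_rfl

end
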